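/- arXiv:0908.1782 — 2 statements merged into one kernel-verified Lean document; each statement's English description precedes it below -/
import Mathlib

section
/- Let τ be an admissible τ-function of length N, let k be the number of markers of τ appearing in the orbit of N, and let l_k = τ(l_k') (with l_k' the smallest such marker when k > 0). Then the number of admissible extensions of τ to length N+1 equals k+2 if k = 0 or l_k > 0, and equals k+1 if k > 0 and l_k = 0. -/
open Function

/-- The order of `n` under `τ`: the least `m` with `τ^[m] n = 0` (junk value `0` if none). -/
noncomputable def ordOf (τ : ℕ → ℕ) (n : ℕ) : ℕ := sInf {m | τ^[m] n = 0}

/-- Property (A): `τ(1) = 0`. -/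
def PropA (τ : ℕ → ℕ) : Prop := τ 1 = 0

/-- Property (B): `τ(n+1) ≤ τ(n) + 1` for all `1 ≤ n ≤ N - 1`. -/
def PropB (N : ℕ) (τ : ℕ → ℕ) : Prop :=
  ∀ n, 1 ≤ n → n + 1 ≤ N → τ (n + 1) ≤ τ n + 1

/-- Property (C): if `τ(n+1) < τ^k(n) + 1` for some `0 < k < ord(n)`, then
`τ(n+1) ≤ τ^{k+1}(n) + 1`. -/
def PropC (N : ℕ) (τ : ℕ → ℕ) : Prop :=
  ∀ n, 1 ≤ n → n + 1 ≤ N → ∀ k, 0 < k → k < ordOf τ n →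
    τ (n + 1) < τ^[k] n + 1 → τ (n + 1) ≤ τ^[k + 1] n + 1

/-- Property (D): if `τ(n+1) < τ^k(n) + 1` for some `0 < k < ord(n)`, and
`τ(τ^k(n)+1) = τ^{k+1}(n)+1`, then `τ(n+1) < τ^{k+1}(n) + 1`. -/
def PropD (N : ℕ) (τ : ℕ → ℕ) : Prop :=
  ∀ n, 1 ≤ n → n + 1 ≤ N → ∀ k, 0 < k → k < ordOf τ n →
    τ (n + 1) < τ^[k] n + 1 → τ (τ^[k] n + 1) = τ^[k + 1] n + 1 →
      τ (n + 1) < τ^[k + 1] n + 1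

/-- Property (E): if `ord(n) > 1` and `ord(τ^{ord(n)-1}(n) + 1) = 1`, then `τ(n+1) ≠ 0`. -/
def PropE (N : ℕ) (τ : ℕ → ℕ) : Prop :=
  ∀ n, 1 ≤ n → n + 1 ≤ N → 1 < ordOf τ n →
    ordOf τ (τ^[ordOf τ n - 1] n + 1) = 1 → τ (n + 1) ≠ 0

/-- An admissible τ-function of length `N`, encoded as a function `ℕ → ℕ` with the
convention `τ 0 = 0`, satisfying properties (A)–(E) on the domain `{1, …, N}`. -/
def Admissible (N : ℕ) (τ : ℕ → ℕ) : Prop :=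
  τ 0 = 0 ∧ PropA τ ∧ PropB N τ ∧ PropC N τ ∧ PropD N τ ∧ PropE N τ

/-- An admissible τ-function of length `N`, normalized to vanish outside `{1, …, N}`
so that τ-functions of length `N` correspond bijectively to such `ℕ → ℕ`. -/
def TauFunction (N : ℕ) (τ : ℕ → ℕ) : Prop :=
  Admissible N τ ∧ ∀ n, N < n → τ n = 0

/-- `m` is a marker of a τ-function of length `N`: `m ∈ {1, …, N-1}` and
`τ(m+1) < τ(m) + 1`. -/
def IsMarker (N : ℕ) (τ : ℕ → ℕ) (m : ℕ) : Prop :=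
  1 ≤ m ∧ m + 1 ≤ N ∧ τ (m + 1) < τ m + 1

/-- `m` is a marker of `τ` appearing in the orbit `N ↦ τ(N) ↦ τ²(N) ↦ ⋯`. -/
def IsMarkerInOrbit (N : ℕ) (τ : ℕ → ℕ) (m : ℕ) : Prop :=
  IsMarker N τ m ∧ ∃ j, 1 ≤ j ∧ τ^[j] N = m

/-- `l` is a marked level of `τ`: `l = τ^n(m)` for some marker `m` and `n > 0`,
with `0` always marked. -/
def IsMarkedLevel (N : ℕ) (τ : ℕ → ℕ) (l : ℕ) : Prop :=
  l = 0 ∨ ∃ m, IsMarker N τ m ∧ ∃ j, 0 < j ∧ τ^[j] m = l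

/-- A marked grid of size `N`: entries `M j k` for `j + k ≤ N` satisfying the
Branner–Hubbard tableau rules (M0)–(M4). -/
def MarkedGrid (N : ℕ) (M : ℕ → ℕ → Prop) : Prop :=
  -- (M0)
  (∀ n, n ≤ N → M n 0 ∧ M 0 n) ∧
  -- (M1)
  (∀ j k, j + k ≤ N → M j k → ∀ l, l ≤ j → M l k) ∧
  -- (M2)
  (∀ j k, j + k ≤ N → M j k → ∀ i, i ≤ j → (M (j - i) (k + i) ↔ M (j - i) i)) ∧
  -- (M3)
  (∀ j k m, j + k < N → 1 ≤ m → m ≤ j → M j k → ¬ M (j + 1) k →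
    (∀ i, 0 < i → i < m → ¬ M (j - i) i) → M (j - m + 1) m → ¬ M (j - m + 1) (k + m)) ∧
  -- (M4)
  (∀ j k, j + k < N → M j k → ¬ M 1 j → M (j + 1) k →
    (∀ i, 0 < i → i < j → ¬ M (j - i) (k + i)) → ¬ M 1 (j + k))



theorem aux_lt {N : ℕ} {τ : ℕ → ℕ} (hA : PropA τ) (hB : PropB N τ) :
    ∀ n, 1 ≤ n → n ≤ N → τ n < n := by
  intro n h1
  induction n, h1 using Nat.le_induction with
  | base => intro _; unfold PropA at hA; omega
  | succ n hn ih =>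
    intro h
    have := hB n hn h
    have := ih (by omega)
    omega

theorem aux_le {N : ℕ} {τ : ℕ → ℕ} (h0 : τ 0 = 0) (hlt : ∀ n, 1 ≤ n → n ≤ N → τ n < n)
    (n : ℕ) (hn : n ≤ N) : τ n ≤ n := by
  rcases Nat.eq_zero_or_pos n with h | h
  · subst h; omega
  · exact (hlt n h hn).le

theorem aux_it_le {N : ℕ} {τ : ℕ → ℕ} (h0 : τ 0 = 0) (hlt : ∀ n, 1 ≤ n → n ≤ N → τ n < n)
    (n : ℕ) (hn : n ≤ N) (j : ℕ) : τ^[j] n ≤ n := by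
  induction j with
  | zero => simp
  | succ j ih =>
    rw [iterate_succ_apply']
    exact (aux_le h0 hlt _ (by omega)).trans ih

theorem aux_anti {N : ℕ} {τ : ℕ → ℕ} (h0 : τ 0 = 0) (hlt : ∀ n, 1 ≤ n → n ≤ N → τ n < n)
    (n : ℕ) (hn : n ≤ N) {i j : ℕ} (hij : i ≤ j) : τ^[j] n ≤ τ^[i] n := by
  obtain ⟨d, rfl⟩ := Nat.exists_eq_add_of_le hij
  rw [Nat.add_comm, iterate_add_apply]
  exact aux_it_le h0 hlt _ ((aux_it_le h0 hlt n hn i).trans hn) d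

theorem aux_ex {N : ℕ} {τ : ℕ → ℕ} (h0 : τ 0 = 0) (hlt : ∀ n, 1 ≤ n → n ≤ N → τ n < n)
    (n : ℕ) (hn : n ≤ N) : ∃ m, τ^[m] n = 0 := by
  induction n using Nat.strong_induction_on with
  | _ n ih =>
    rcases Nat.eq_zero_or_pos n with h | h
    · exact ⟨0, by simpa using h⟩
    · have := hlt n h hn
      obtain ⟨m, hm⟩ := ih (τ n) this (by omega)
      exact ⟨m + 1, by rwa [iterate_succ_apply]⟩

theorem aux_ord {N : ℕ} {τ : ℕ → ℕ} (h0 : τ 0 = 0) (hlt : ∀ n, 1 ≤ n → n ≤ N → τ n < n)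
    (n : ℕ) (hn : n ≤ N) (j : ℕ) : j < ordOf τ n ↔ 0 < τ^[j] n := by
  have hz : τ^[ordOf τ n] n = 0 := Nat.sInf_mem (s := {m | τ^[m] n = 0}) (aux_ex h0 hlt n hn)
  constructor
  · intro h
    by_contra hc
    have : ordOf τ n ≤ j := Nat.sInf_le (show τ^[j] n = 0 by omega)
    omega
  · intro h
    by_contra hc
    have := aux_anti h0 hlt n hn (show ordOf τ n ≤ j by omega)
    omega

theorem aux_it_congr {N : ℕ} {τ τ' : ℕ → ℕ} (h0 : τ 0 = 0)
    (hlt : ∀ n, 1 ≤ n → n ≤ N → τ n < n)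
    (hag : ∀ n, n ≤ N → τ' n = τ n) (n : ℕ) (hn : n ≤ N) (j : ℕ) : τ'^[j] n = τ^[j] n := by
  induction j with
  | zero => simp
  | succ j ih =>
    rw [iterate_succ_apply', iterate_succ_apply', ih]
    exact hag _ ((aux_it_le h0 hlt n hn j).trans hn)

theorem aux_ord_congr {N : ℕ} {τ τ' : ℕ → ℕ} (h0 : τ 0 = 0)
    (hlt : ∀ n, 1 ≤ n → n ≤ N → τ n < n)
    (hag : ∀ n, n ≤ N → τ' n = τ n) (n : ℕ) (hn : n ≤ N) : ordOf τ' n = ordOf τ n := by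
  unfold ordOf
  simp only [aux_it_congr h0 hlt hag n hn]

/-- Conditions on the value `v` at `N+1`. -/
def ValidExt (N : ℕ) (τ : ℕ → ℕ) (v : ℕ) : Prop :=
  v ≤ τ N + 1 ∧
  (∀ k, 0 < k → k < ordOf τ N → v < τ^[k] N + 1 → v ≤ τ^[k + 1] N + 1) ∧
  (∀ k, 0 < k → k < ordOf τ N → v < τ^[k] N + 1 → τ (τ^[k] N + 1) = τ^[k + 1] N + 1 →
      v < τ^[k + 1] N + 1) ∧
  (1 < ordOf τ N → ordOf τ (τ^[ordOf τ N - 1] N + 1) = 1 → v ≠ 0)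

theorem aux_step {N : ℕ} {τ : ℕ → ℕ} (h0 : τ 0 = 0)
    (hlt : ∀ n, 1 ≤ n → n ≤ N → τ n < n) {n k : ℕ} (hn : n ≤ N) (hk : 0 < k)
    (hko : k < ordOf τ n) : τ^[k] n + 1 ≤ n := by
  have h1 := (aux_ord h0 hlt n hn k).1 hko
  have h2 := aux_anti h0 hlt n hn (show 1 ≤ k by omega)
  simp only [iterate_one] at h2
  rcases Nat.eq_zero_or_pos n with h | h
  · subst h; omega
  · have := hlt n h hn
    omega

theorem aux_adm {N : ℕ} (hN : 1 ≤ N) {τ τ' : ℕ → ℕ} (hτ : Admissible N τ)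
    (hag : ∀ n, n ≤ N → τ' n = τ n) : Admissible (N + 1) τ' ↔ ValidExt N τ (τ' (N + 1)) := by
  obtain ⟨h0, hA, hB, hC, hD, hE⟩ := hτ
  have hlt := aux_lt hA hB
  have hit := aux_it_congr h0 hlt hag
  have hor := aux_ord_congr h0 hlt hag
  have hE' : ∀ n, n ≤ N → 1 < ordOf τ n →
      ordOf τ' (τ^[ordOf τ n - 1] n + 1) = ordOf τ (τ^[ordOf τ n - 1] n + 1) := by
    intro n hn ho
    exact hor _ ((aux_step h0 hlt hn (by omega) (by omega)).trans hn)
  constructor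
  · rintro ⟨-, -, hB', hC', hD', hE''⟩
    have b := hB' N hN le_rfl
    have c := hC' N hN le_rfl
    have d := hD' N hN le_rfl
    have e := hE'' N hN le_rfl
    simp only [hit N le_rfl, hor N le_rfl, hag N le_rfl] at b c d e
    refine ⟨b, c, ?_, ?_⟩
    · intro k hk hko h1 h2
      exact d k hk hko h1 (by rw [hag _ (aux_step h0 hlt le_rfl hk hko)]; exact h2)
    · intro h1 h2
      exact e h1 (by rw [hE' N le_rfl h1]; exact h2)
  · rintro ⟨b, c, d, e⟩
    refine ⟨by rw [hag 0 (by omega)]; exact h0, by unfold PropA; rw [hag 1 hN]; exact hA,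
      ?_, ?_, ?_, ?_⟩
    · intro n h1 h2
      rcases Nat.lt_or_ge n N with h | h
      · rw [hag n h.le, hag (n + 1) h]; exact hB n h1 h
      · obtain rfl : n = N := by omega
        rw [hag n le_rfl]; exact b
    · intro n h1 h2 k hk hko
      rw [hor n (by omega)] at hko
      rw [hit n (by omega), hit n (by omega)]
      rcases Nat.lt_or_ge n N with h | h
      · rw [hag (n + 1) h]; exact hC n h1 h k hk hko
      · obtain rfl : n = N := by omega
        exact c k hk hko
    · intro n h1 h2 k hk hko
      rw [hor n (by omega)] at hko
      rw [hit n (by omega), hit n (by omega),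
        hag _ ((aux_step h0 hlt (show n ≤ N by omega) hk hko).trans (by omega))]
      rcases Nat.lt_or_ge n N with h | h
      · rw [hag (n + 1) h]; exact hD n h1 h k hk hko
      · obtain rfl : n = N := by omega
        exact d k hk hko
    · intro n h1 h2 ho
      rw [hor n (by omega)] at ho
      rw [hor n (by omega), hit n (by omega), hE' n (by omega) ho]
      rcases Nat.lt_or_ge n N with h | h
      · rw [hag (n + 1) h]; exact hE n h1 h ho
      · obtain rfl : n = N := by omega
        exact e ho

theorem aux_valid_pos {N : ℕ} (hN : 1 ≤ N) {τ : ℕ → ℕ} (hτ : Admissible N τ) (v : ℕ)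
    (hv : 0 < v) :
    ValidExt N τ v ↔ (v = τ N + 1 ∨ ∃ m, IsMarkerInOrbit N τ m ∧ v = τ m + 1) := by
  obtain ⟨h0, hA, hB, hC, hD, hE⟩ := hτ
  have hlt := aux_lt hA hB
  have hord := aux_ord h0 hlt N le_rfl
  constructor
  · rintro ⟨b, c, d, -⟩
    have hex : ∃ j, τ^[j + 1] N + 1 ≤ v := by
      obtain ⟨m, hm⟩ := aux_ex h0 hlt N le_rfl
      have := aux_anti h0 hlt N le_rfl (show m ≤ m + 1 by omega)
      exact ⟨m, by omega⟩
    classical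
    have hs := Nat.find_spec hex
    have hmin := fun j => Nat.find_min hex (m := j)
    generalize Nat.find hex = j at hs hmin
    rcases j with _ | j
    · left
      simp only [Nat.zero_add, iterate_one] at hs
      omega
    · right
      have h1 := hmin j (by omega)
      have h2 : j + 1 < ordOf τ N := (hord _).2 (by omega)
      have h3 := c (j + 1) (by omega) h2 (by omega)
      have h4 := aux_step h0 hlt le_rfl (show 0 < j + 1 by omega) h2
      have h5 : τ (τ^[j + 1] N) = τ^[j + 1 + 1] N := (iterate_succ_apply' τ (j + 1) N).symm
      refine ⟨τ^[j + 1] N, ⟨⟨by omega, h4, ?_⟩, j + 1, by omega, rfl⟩, by omega⟩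
      have h6 := hB (τ^[j + 1] N) (by omega) h4
      have h7 := d (j + 1) (by omega) h2 (by omega)
      by_contra hc
      have := h7 (by omega)
      omega
  · rintro (rfl | ⟨m, ⟨⟨hm1, hm2, hm3⟩, j, hj, rfl⟩, rfl⟩)
    · have key : ∀ k, 0 < k → τ^[k] N ≤ τ N := fun k hk => by
        simpa using aux_anti h0 hlt N le_rfl (show 1 ≤ k by omega)
      refine ⟨le_rfl, ?_, ?_, fun _ _ => by omega⟩
      · intro k hk _ h
        have := key k hk
        omega
      · intro k hk _ h
        have := key k hk
        omega
    · have h5 : τ (τ^[j] N) = τ^[j + 1] N := (iterate_succ_apply' τ j N).symm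
      rw [h5] at hm3 ⊢
      have h6 := hlt (τ^[j] N) (by omega) (by omega)
      have hle : ∀ {i k}, i ≤ k → τ^[k] N ≤ τ^[i] N := fun h => aux_anti h0 hlt N le_rfl h
      refine ⟨?_, ?_, ?_, fun _ _ => by omega⟩
      · have := hle (show 1 ≤ j + 1 by omega)
        simpa using this
      · intro k hk _ h
        have : k ≤ j := by
          by_contra hc
          have := hle (show j + 1 ≤ k by omega)
          omega
        have := hle (show k + 1 ≤ j + 1 by omega)
        omega
      · intro k hk _ h hm
        have : k ≤ j := by
          by_contra hc
          have := hle (show j + 1 ≤ k by omega)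
          omega
        rcases Nat.lt_or_ge k j with hkj | hkj
        · have := hle (show k + 1 ≤ j by omega)
          omega
        · obtain rfl : k = j := by omega
          omega

theorem aux_valid_zero {N : ℕ} (hN : 1 ≤ N) {τ : ℕ → ℕ} (hτ : Admissible N τ) :
    ValidExt N τ 0 ↔ ∀ m, IsMarkerInOrbit N τ m → 0 < τ m := by
  obtain ⟨h0, hA, hB, hC, hD, hE⟩ := hτ
  have hlt := aux_lt hA hB
  have hord := aux_ord h0 hlt N le_rfl
  constructor
  · rintro ⟨-, -, -, e⟩ m ⟨⟨hm1, hm2, hm3⟩, j, hj, rfl⟩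
    by_contra hc
    have h5 : τ (τ^[j] N) = τ^[j + 1] N := (iterate_succ_apply' τ j N).symm
    have h1 := (hord j).2 (by omega)
    have h2 : ¬ j + 1 < ordOf τ N := fun h => by
      have := (hord _).1 h
      omega
    have h3 : ordOf τ N - 1 = j := by omega
    refine e (by omega) ?_ rfl
    rw [h3]
    have o := aux_ord h0 hlt (τ^[j] N + 1) hm2
    have o0 := (o 0).2 (by simp)
    have o1 := (o 1)
    simp only [iterate_one] at o1
    have : ¬ 1 < ordOf τ (τ^[j] N + 1) := fun h => by
      have := o1.1 h
      omega
    omega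
  · intro H
    refine ⟨by omega, fun _ _ _ _ => by omega, fun _ _ _ _ _ => by omega, ?_⟩
    intro ho h1 _
    obtain ⟨j, hj⟩ : ∃ j, ordOf τ N = j + 1 := ⟨ordOf τ N - 1, by omega⟩
    rw [hj] at h1
    simp only [Nat.add_sub_cancel] at h1
    have hs := aux_step h0 hlt le_rfl (show 0 < j by omega) (show j < ordOf τ N by omega)
    have hp := (hord j).1 (by omega)
    have h5 : τ (τ^[j] N) = τ^[j + 1] N := (iterate_succ_apply' τ j N).symm
    have hz : ¬ 0 < τ^[j + 1] N := fun h => by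
      have := (hord (j + 1)).2 h
      omega
    have o := aux_ord h0 hlt (τ^[j] N + 1) hs 1
    simp only [iterate_one] at o
    have hz' : ¬ 0 < τ (τ^[j] N + 1) := fun h => by
      have := o.2 h
      omega
    have := H (τ^[j] N) ⟨⟨hp, hs, by omega⟩, j, by omega, rfl⟩
    omega

/-- the number of admissible extensions of an admissible τ-function of
length `N` to length `N + 1` is `k + 2` if `k = 0` or `lₖ > 0`, and `k + 1` if
`k > 0` and `lₖ = 0`, where `k` is the number of markers in the orbit of `N` and
`lₖ = τ(l'ₖ)` for the smallest such marker `l'ₖ`. -/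
theorem card_extensions (N k : ℕ) (hN : 1 ≤ N) (τ : ℕ → ℕ) (hτ : TauFunction N τ)
    (l' : Fin (k + 1) → ℕ) (hl0 : l' 0 = N) (hanti : StrictAnti l')
    (henum : ∀ m, IsMarkerInOrbit N τ m ↔ ∃ i : Fin (k + 1), i ≠ 0 ∧ l' i = m) :
    Nat.card {τ' : ℕ → ℕ //
        TauFunction (N + 1) τ' ∧ ∀ n, 1 ≤ n → n ≤ N → τ' n = τ n} =
      if k = 0 ∨ 0 < τ (l' (Fin.last k)) then k + 2 else k + 1 := by
  classical
  obtain ⟨hadm, hvan⟩ := hτ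
  have hadm' := hadm
  obtain ⟨h0, hA, hB, hC, hD, hE⟩ := hadm'
  have hlt := aux_lt hA hB
  -- orbit membership
  have horb : ∀ i, ∃ j, τ^[j] N = l' i := by
    intro i
    by_cases hi : i = 0
    · exact ⟨0, by simp [hi, hl0]⟩
    · obtain ⟨-, j, -, h⟩ := (henum (l' i)).2 ⟨i, hi, rfl⟩
      exact ⟨j, h⟩
  have hpos : ∀ i, 0 < l' i := by
    intro i
    by_cases hi : i = 0
    · rw [hi, hl0]; omega
    · exact ((henum (l' i)).2 ⟨i, hi, rfl⟩).1.1
  have hanti2 : StrictAnti (fun i => τ (l' i)) := by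
    intro i i' hii
    have h1 := hanti hii
    obtain ⟨j, hj⟩ := horb i
    obtain ⟨j', hj'⟩ := horb i'
    have h2 : j < j' := by
      by_contra hc
      have := aux_anti h0 hlt N le_rfl (show j' ≤ j by omega)
      omega
    have h3 := aux_anti h0 hlt N le_rfl (show j + 1 ≤ j' by omega)
    rw [iterate_succ_apply', hj, hj'] at h3
    have h4 := hlt (l' i') (hpos i') (by rw [← hj']; exact aux_it_le h0 hlt N le_rfl j')
    show τ (l' i') < τ (l' i)
    omega
  set F : Finset ℕ := Finset.univ.image (fun i => τ (l' i) + 1) with hF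
  have hFcard : F.card = k + 1 := by
    rw [hF, Finset.card_image_of_injective]
    · simp
    · intro i j hij
      exact hanti2.injective (by simpa using hij)
  have hF0 : 0 ∉ F := by simp [hF]
  have hvp : ∀ v, 0 < v → (ValidExt N τ v ↔ v ∈ F) := by
    intro v hv
    rw [aux_valid_pos hN hadm v hv, hF]
    simp only [Finset.mem_image, Finset.mem_univ, true_and]
    constructor
    · rintro (h | ⟨m, hm, h⟩)
      · exact ⟨0, by rw [hl0, h]⟩
      · obtain ⟨i, -, rfl⟩ := (henum m).1 hm
        exact ⟨i, h.symm⟩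
    · rintro ⟨i, h⟩
      by_cases hi : i = 0
      · left; rw [← h, hi, hl0]
      · right; exact ⟨l' i, (henum _).2 ⟨i, hi, rfl⟩, h.symm⟩
  have hv0 : ValidExt N τ 0 ↔ (k = 0 ∨ 0 < τ (l' (Fin.last k))) := by
    rw [aux_valid_zero hN hadm]
    constructor
    · intro H
      by_cases hk : k = 0
      · left; exact hk
      · right
        refine H _ ((henum _).2 ⟨Fin.last k, ?_, rfl⟩)
        intro h
        have := congrArg Fin.val h
        simp at this
        exact hk this
    · rintro H m hm
      obtain ⟨i, hi, rfl⟩ := (henum m).1 hm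
      rcases H with rfl | H
      · exact absurd (Fin.ext (by simp)) hi
      · exact lt_of_lt_of_le H (hanti2.antitone (Fin.le_last i))
  set G : Finset ℕ := if k = 0 ∨ 0 < τ (l' (Fin.last k)) then insert 0 F else F with hG
  have hGmem : ∀ v, v ∈ G ↔ ValidExt N τ v := by
    intro v
    rcases Nat.eq_zero_or_pos v with rfl | hv
    · rw [hv0, hG]
      split_ifs with h
      · simp [h]
      · simp [h, hF0]
    · rw [hvp v hv, hG]
      split_ifs with h
      · simp [hv.ne']
      · rfl
  have hGcard : G.card = if k = 0 ∨ 0 < τ (l' (Fin.last k)) then k + 2 else k + 1 := by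
    rw [hG]
    split_ifs with h
    · rw [Finset.card_insert_of_notMem hF0, hFcard]
    · exact hFcard
  rw [← hGcard, ← Fintype.card_coe G, ← Nat.card_eq_fintype_card]
  have hag : ∀ τ' : ℕ → ℕ, τ' 0 = 0 → (∀ n, 1 ≤ n → n ≤ N → τ' n = τ n) →
      ∀ n, n ≤ N → τ' n = τ n := by
    intro τ' hz h n hn
    rcases Nat.eq_zero_or_pos n with rfl | hp
    · rw [hz, h0]
    · exact h n hp hn
  refine Nat.card_eq_of_bijective (fun τ' => (⟨τ'.1 (N + 1), (hGmem _).2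
    ((aux_adm hN hadm (hag τ'.1 τ'.2.1.1.1 τ'.2.2)).1 τ'.2.1.1)⟩ : G)) ⟨?_, ?_⟩
  · rintro ⟨f, hf1, hf2⟩ ⟨g, hg1, hg2⟩ hfg
    have hfg' : f (N + 1) = g (N + 1) := congrArg Subtype.val hfg
    apply Subtype.ext
    funext n
    show f n = g n
    rcases Nat.lt_trichotomy n (N + 1) with h | h | h
    · rw [hag f hf1.1.1 hf2 n (by omega), hag g hg1.1.1 hg2 n (by omega)]
    · rw [h, hfg']
    · rw [hf1.2 n h, hg1.2 n h]
  · rintro ⟨v, hv⟩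
    have hu : ∀ n, n ≤ N → Function.update τ (N + 1) v n = τ n := fun n hn =>
      Function.update_of_ne (by omega) _ _
    refine ⟨⟨Function.update τ (N + 1) v, ⟨?_, ?_⟩, fun n _ hn => hu n hn⟩, ?_⟩
    · rw [aux_adm hN hadm hu, Function.update_self]
      exact (hGmem v).1 hv
    · intro n hn
      rw [Function.update_of_ne (by omega)]
      exact hvan n (by omega)
    · apply Subtype.ext
      simp
end

section
/- The number of admissible τ-functions of length 9 equals 303. -/
open Function

/-- Inner local condition. -/
def StepQ (n : ℕ) (f : ℕ → ℕ) (k : ℕ) : Prop :=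
    (0 < k → f^[k] n ≠ 0 →
    ((f (n + 1) < f^[k] n + 1 → f (n + 1) ≤ f^[k + 1] n + 1) ∧
     (f (n + 1) < f^[k] n + 1 → f (f^[k] n + 1) = f^[k + 1] n + 1 →
        f (n + 1) < f^[k + 1] n + 1) ∧
     (f^[k + 1] n = 0 → f (f^[k] n + 1) = 0 → f (n + 1) ≠ 0)))

instance stepQDec (n : ℕ) (f : ℕ → ℕ) (k : ℕ) : Decidable (StepQ n f k) := by
  unfold StepQ; infer_instance

/-- Local condition at `n`, orders eliminated. -/
def StepP (n : ℕ) (f : ℕ → ℕ) : Prop :=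
  f (n + 1) ≤ f n + 1 ∧ ∀ k, k < 9 → StepQ n f k

instance stepDec (n : ℕ) (f : ℕ → ℕ) : Decidable (StepP n f) := by
  unfold StepP; infer_instance

def genT : ℕ → List (List ℕ)
  | 0 => [[0, 0]]
  | n + 1 => (genT n).flatMap fun l =>
      ((List.range (n + 2)).map fun v => l ++ [v]).filter
        fun l' => decide (StepP (n + 1) (fun i => l'.getD i 0))

theorem genT_len (n : ℕ) : ∀ l ∈ genT n, l.length = n + 2 := by
  induction n with
  | zero => simp [genT]
  | succ n ih =>
    intro l hl
    simp only [genT, List.mem_flatMap, List.mem_filter, List.mem_map] at hl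
    obtain ⟨a, ha, ⟨v, -, rfl⟩, -⟩ := hl
    simp [ih a ha]

theorem iter_le {f : ℕ → ℕ} {n : ℕ} (h : ∀ m ≤ n, f m ≤ m - 1) (k : ℕ) :
    f^[k] n ≤ n - k := by
  induction k with
  | zero => simp
  | succ k ih =>
    rw [iterate_succ_apply']
    have := h (f^[k] n) (by omega)
    omega

theorem iter_congr {f g : ℕ → ℕ} {n : ℕ} (h : ∀ m ≤ n, f m ≤ m - 1)
    (hg : ∀ m ≤ n, g m = f m) (k : ℕ) : g^[k] n = f^[k] n := by
  induction k with
  | zero => simp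
  | succ k ih =>
    rw [iterate_succ_apply', iterate_succ_apply', ih]
    have := iter_le h k
    exact hg _ (by omega)

theorem step_congr {f g : ℕ → ℕ} {n : ℕ} (h : ∀ m ≤ n, f m ≤ m - 1)
    (hg : ∀ m ≤ n + 1, g m = f m) : StepP n g ↔ StepP n f := by
  unfold StepP StepQ
  have e1 := hg (n + 1) le_rfl
  have e0 := hg n (by omega)
  have ei := iter_congr h (fun m hm => hg m (by omega))
  have e2 : ∀ k, g (f^[k] n + 1) = f (f^[k] n + 1) := fun k => by
    have := iter_le h k
    exact hg _ (by omega)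
  simp only [e1, e0, ei, e2]

theorem bound {f : ℕ → ℕ} {N : ℕ} (h0 : f 0 = 0) (h1 : f 1 = 0)
    (h : ∀ m, 1 ≤ m → m + 1 ≤ N → f (m + 1) ≤ f m + 1) : ∀ m ≤ N, f m ≤ m - 1 := by
  intro m
  induction m with
  | zero => intro _; omega
  | succ m ih =>
    intro hm
    rcases Nat.eq_zero_or_pos m with rfl | hp
    · simp [h1]
    · have := h m hp hm
      have := ih (by omega)
      omega

theorem mem_genT {f : ℕ → ℕ} (h0 : f 0 = 0) (n : ℕ) :
    (List.range (n + 2)).map f ∈ genT n ↔ f 1 = 0 ∧ ∀ m, 1 ≤ m → m ≤ n → StepP m f := by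
  induction n with
  | zero =>
    simp [genT, List.range_succ, h0]
    intros; omega
  | succ n ih =>
    have hgetD : ∀ m ≤ n + 2, ((List.range (n + 1 + 2)).map f).getD m 0 = f m := by
      intro m hm
      simp [List.getD, List.getElem?_range (show m < n + 1 + 2 by omega)]
    have hcat : (List.range (n + 1 + 2)).map f = (List.range (n + 2)).map f ++ [f (n + 2)] := by
      rw [List.range_succ (n := n + 2)]; simp
    constructor
    · intro hl
      simp only [genT, List.mem_flatMap, List.mem_filter, List.mem_map, decide_eq_true_eq] at hl
      obtain ⟨a, ha, ⟨v, -, hv⟩, hs⟩ := hl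
      have haa : a = (List.range (n + 2)).map f := by
        rw [hcat] at hv
        exact (List.append_inj' hv rfl).1
      rw [haa, ih] at ha
      refine ⟨ha.1, fun m hm hm' => ?_⟩
      rcases Nat.lt_or_ge n m with hlt | hge
      · obtain rfl : m = n + 1 := by omega
        refine (step_congr ?_ hgetD).1 hs
        exact bound h0 ha.1 (fun m h1 h2 => (ha.2 m h1 (by omega)).1)
      · exact ha.2 m hm hge
    · rintro ⟨h1, hs⟩
      have hb := bound (N := n + 2) h0 h1 (fun m a b => (hs m a (by omega)).1)
      simp only [genT, List.mem_flatMap, List.mem_filter, List.mem_map, decide_eq_true_eq]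
      refine ⟨_, ih.2 ⟨h1, fun m a b => hs m a (by omega)⟩, ⟨f (n + 2), ?_, hcat.symm⟩, ?_⟩
      · have := hb (n + 2) le_rfl
        simp; omega
      · exact (step_congr (fun m hm => hb m (by omega)) hgetD).2 (hs _ (by omega) le_rfl)

theorem iter_zero {f : ℕ → ℕ} (h0 : f 0 = 0) {n a b : ℕ} (hab : a ≤ b) (h : f^[a] n = 0) :
    f^[b] n = 0 := by
  obtain ⟨c, rfl⟩ := Nat.exists_eq_add_of_le hab
  rw [Nat.add_comm, iterate_add_apply, h]
  exact iterate_fixed h0 c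

theorem lt_ord {f : ℕ → ℕ} (h0 : f 0 = 0) {n : ℕ} (h : ∃ m, f^[m] n = 0) (k : ℕ) :
    k < ordOf f n ↔ f^[k] n ≠ 0 := by
  constructor
  · intro hk he
    exact absurd (Nat.sInf_le (s := {m | f^[m] n = 0}) he) (by unfold ordOf at hk; omega)
  · intro hk
    by_contra hlt
    have : f^[ordOf f n] n = 0 := Nat.sInf_mem (s := {m | f^[m] n = 0}) h
    exact hk (iter_zero h0 (by omega) this)

theorem adm_iff {f : ℕ → ℕ} (h0 : f 0 = 0) :
    Admissible 9 f ↔ f 1 = 0 ∧ ∀ m, 1 ≤ m → m ≤ 8 → StepP m f := by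
  have key : f 1 = 0 → PropB 9 f → (∀ n ≤ 9, ∀ k, k < ordOf f n ↔ f^[k] n ≠ 0) ∧
      (∀ n ≤ 8, ∀ k, f^[k] n ≤ n - k) := by
    intro h1 hB
    have hb := bound h0 h1 hB
    refine ⟨fun n hn k => lt_ord h0 ⟨n, ?_⟩ k,
      fun n hn k => iter_le (fun m hm => hb m (by omega)) k⟩
    have := iter_le (f := f) (n := n) (fun m hm => hb m (by omega)) n
    omega
  constructor
  · rintro ⟨-, hA, hB, hC, hD, hE⟩
    obtain ⟨ho, hi⟩ := key hA hB
    refine ⟨hA, fun n hn hn8 => ⟨hB n hn (by omega), fun k _ hk hne => ?_⟩⟩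
    have hlt := (ho n (by omega) k).2 hne
    refine ⟨hC n hn (by omega) k hk hlt, hD n hn (by omega) k hk hlt, fun hz hz' => ?_⟩
    have hnl : ¬ (k + 1 < ordOf f n) := fun h => (ho n (by omega) _).1 h hz
    have hord : ordOf f n = k + 1 := by omega
    refine hE n hn (by omega) (by omega) ?_
    rw [hord, Nat.add_sub_cancel]
    have hle := hi n hn8 k
    have a := (ho (f^[k] n + 1) (by omega) 0).2 (by simp)
    have b : ¬ _ := fun h => (ho (f^[k] n + 1) (by omega) 1).1 h (by simpa using hz')
    omega
  · rintro ⟨h1, hs⟩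
    have hB : PropB 9 f := fun n a b => (hs n a (by omega)).1
    obtain ⟨ho, hi⟩ := key h1 hB
    have hk9 : ∀ n ≤ 8, ∀ k, k < ordOf f n → k < 9 := by
      intro n hn k hk
      have := (ho n (by omega) k).1 hk
      have := hi n hn k
      omega
    refine ⟨h0, h1, hB, ?_, ?_, ?_⟩
    · intro n a b k hk hlt
      exact ((hs n a (by omega)).2 k (hk9 n (by omega) k hlt) hk ((ho n (by omega) k).1 hlt)).1
    · intro n a b k hk hlt
      exact ((hs n a (by omega)).2 k (hk9 n (by omega) k hlt) hk ((ho n (by omega) k).1 hlt)).2.1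
    · intro n a b hlt he
      have hl : ordOf f n - 1 < ordOf f n := by omega
      refine ((hs n a (by omega)).2 (ordOf f n - 1) (hk9 n (by omega) _ hl) (by omega)
        ((ho n (by omega) _).1 hl)).2.2 ?_ ?_
      · by_contra hc
        have := (ho n (by omega) _).2 hc
        omega
      · have hle := hi n (by omega) (ordOf f n - 1)
        by_contra hc
        have := (ho (f^[ordOf f n - 1] n + 1) (by omega) 1).2 (by simpa using hc)
        omega

theorem genT_nodup (n : ℕ) : (genT n).Nodup := by
  induction n with
  | zero => simp [genT]
  | succ n ih =>
    rw [genT, List.nodup_flatMap]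
    refine ⟨fun l _ => (List.Nodup.map (fun a b h => by simpa using h) List.nodup_range).filter _, ?_⟩
    refine ih.imp ?_
    intro a b hab x hx hy
    simp only [List.mem_filter, List.mem_map] at hx hy
    obtain ⟨⟨v, -, rfl⟩, -⟩ := hx
    obtain ⟨⟨w, -, hw⟩, -⟩ := hy
    exact hab (List.append_inj' hw rfl).1.symm

theorem genT_head (n : ℕ) : ∀ l ∈ genT n, l.getD 0 0 = 0 := by
  induction n with
  | zero => simp [genT]
  | succ n ih =>
    intro l hl
    simp only [genT, List.mem_flatMap, List.mem_filter, List.mem_map] at hl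
    obtain ⟨a, ha, ⟨v, -, rfl⟩, -⟩ := hl
    have h1 := ih a ha
    have h2 := genT_len n a ha
    rw [List.getD_append _ _ _ _ (by omega)]
    exact h1

theorem genT_count : (genT 8).length = 303 := by decide +kernel

/-- the number of admissible τ-functions of length 9 equals 303. -/
theorem card_tau_length_9 :
    Nat.card {τ : ℕ → ℕ // TauFunction 9 τ} = 303 := by
  have hmem : ∀ τ : ℕ → ℕ, TauFunction 9 τ → (List.range 10).map τ ∈ (genT 8).toFinset := by
    intro τ h
    rw [List.mem_toFinset]
    exact (mem_genT h.1.1 8).2 ((adm_iff h.1.1).1 h.1)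
  have hbij : Bijective (fun τ : {τ : ℕ → ℕ // TauFunction 9 τ} =>
      (⟨(List.range 10).map τ.1, hmem τ.1 τ.2⟩ : {l // l ∈ (genT 8).toFinset})) := by
    constructor
    · rintro ⟨σ, hσ⟩ ⟨τ, hτ⟩ h
      have h' : (List.range 10).map σ = (List.range 10).map τ := congrArg Subtype.val h
      refine Subtype.ext (funext fun n => ?_)
      rcases Nat.lt_or_ge n 10 with hn | hn
      · exact List.map_inj_left.1 h' n (by simpa using hn)
      · exact (hσ.2 n (by omega)).trans (hτ.2 n (by omega)).symm
    · rintro ⟨l, hl⟩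
      have hl' := List.mem_toFinset.1 hl
      have hlen := genT_len 8 l hl'
      have hhead := genT_head 8 l hl'
      have hmap : (List.range 10).map (fun i => l.getD i 0) = l := by
        apply List.ext_getElem
        · simp [hlen]
        · intro i h1 h2
          simp [List.getD, h2]
      refine ⟨⟨fun i => l.getD i 0, ?_, ?_⟩, Subtype.ext hmap⟩
      · refine (adm_iff (f := fun i => l.getD i 0) hhead).2
          ((mem_genT (f := fun i => l.getD i 0) hhead 8).1 ?_)
        rw [show 8 + 2 = 10 from rfl, hmap]
        exact hl'
      · intro n hn
        simp [List.getD, List.getElem?_eq_none (show l.length ≤ n by omega)]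
  rw [Nat.card_eq_of_bijective _ hbij, Nat.card_eq_fintype_card, Fintype.card_coe,
    List.toFinset_card_of_nodup (genT_nodup 8), genT_count]
end
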